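/- Let (X, μ) be a measure space, let p, q ∈ ℝ, let M be the 2×2 real matrix with rows (p, q) and (−q, p), and let v_min > 0. Let v₁, v₂ : X → ℝ² (Euclidean) be a.e.-strongly-measurable functions such that ‖v₁(t)‖ ≥ v_min and ‖v₂(t)‖ ≥ v_min for μ-almost every t. Then the L²-seminorm satisfies eLpNorm (fun t ↦ (1/‖v₂(t)‖²)·M v₂(t) − (1/‖v₁(t)‖²)·M v₁(t)) 2 μ ≤ (√(p² + q²)/v_min²) · eLpNorm (fun t ↦ v₂(t) − v₁(t)) 2 μ. Consequently, the incremental L²-gain of the constant power load over such signal pairs is at most σ_max(M)/v_min². -/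

import Mathlib

open Matrix MeasureTheory

theorem cpl_norm_apply (p q : ℝ) (v : EuclideanSpace ℝ (Fin 2)) :
    ‖Matrix.toEuclideanLin (!![p, q; -q, p]) v‖ = Real.sqrt (p ^ 2 + q ^ 2) * ‖v‖ := by
  rw [EuclideanSpace.norm_eq, EuclideanSpace.norm_eq, ← Real.sqrt_mul (by positivity)]
  congr 1
  simp [Fin.sum_univ_two, Matrix.toLpLin_apply, Matrix.mulVec, dotProduct]
  ring

/-- Signal-space form of Lemma 1: the incremental `L²`-gain of the constant power load
`v ↦ M v / ‖v‖²` with `M = [[p, q], [-q, p]]` over signals whose pointwise norm stays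
above `v_min` is at most `σ_max(M) / v_min² = √(p² + q²) / v_min²`. -/
theorem cpl_incremental_L2_gain {X : Type*} [MeasurableSpace X] (μ : Measure X)
    (p q : ℝ) (vmin : ℝ) (hvmin : 0 < vmin)
    (v₁ v₂ : X → EuclideanSpace ℝ (Fin 2))
    (hm₁ : AEStronglyMeasurable v₁ μ) (hm₂ : AEStronglyMeasurable v₂ μ)
    (h₁ : ∀ᵐ t ∂μ, vmin ≤ ‖v₁ t‖) (h₂ : ∀ᵐ t ∂μ, vmin ≤ ‖v₂ t‖) :
    eLpNorm (fun t =>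
        (1 / ‖v₂ t‖ ^ 2) • Matrix.toEuclideanLin (!![p, q; -q, p]) (v₂ t) -
        (1 / ‖v₁ t‖ ^ 2) • Matrix.toEuclideanLin (!![p, q; -q, p]) (v₁ t)) 2 μ ≤
      ENNReal.ofReal (Real.sqrt (p ^ 2 + q ^ 2) / vmin ^ 2) *
        eLpNorm (fun t => v₂ t - v₁ t) 2 μ := by
  refine eLpNorm_le_mul_eLpNorm_of_ae_le_mul ?_ 2
  filter_upwards [h₁, h₂] with t ht₁ ht₂
  have p₁ : 0 < ‖v₁ t‖ := hvmin.trans_le ht₁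
  have p₂ : 0 < ‖v₂ t‖ := hvmin.trans_le ht₂
  have key := dist_div_norm_sq_smul (norm_pos_iff.1 p₂) (norm_pos_iff.1 p₁) 1
  rw [dist_eq_norm, dist_eq_norm, div_pow, div_pow, one_pow] at key
  rw [← map_smul, ← map_smul, ← map_sub, cpl_norm_apply, key, ← mul_assoc]
  refine mul_le_mul_of_nonneg_right ?_ (norm_nonneg _)
  rw [mul_one_div]
  refine div_le_div_of_nonneg_left (Real.sqrt_nonneg _) (by positivity) ?_
  rw [sq]
  exact mul_le_mul ht₂ ht₁ hvmin.le p₂.le
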